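/- Let M₂ be the Turing machine with states {A,B,H} and symbols {0,1,2,3} whose transition table is: δ(A,0)=(1,R,B), δ(A,1)=(2,L,A), δ(A,2)=(1,R,A), δ(A,3)=(1,R,A); δ(B,0)=(1,L,B), δ(B,1)=(1,L,A), δ(B,2)=(3,R,B), δ(B,3)=(1,R,H). Then, started on a blank tape, M₂ halts: ^ω0 (A0) 0^ω ⊢(3932964) ^ω0 1 3^{2047} 1 (H1) 0^ω. In particular M₂ halts in exactly 3,932,964 steps and its halting configuration carries exactly 2050 non-blank symbols. -/

import Mathlib

open Turing

inductive TSt where | A | B | H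
deriving DecidableEq

inductive Gam where | s0 | s1 | s2 | s3
deriving DecidableEq

instance : Inhabited Gam := ⟨Gam.s0⟩

abbrev Cfg := TSt × Tape Gam

/-- The transition table of the machine (values from the halting state `H` are never used). -/
def delta : TSt → Gam → Gam × Dir × TSt
  | .A, .s0 => (.s1, Dir.right, .B)
  | .A, .s1 => (.s2, Dir.left, .A)
  | .A, .s2 => (.s1, Dir.right, .A)
  | .A, .s3 => (.s1, Dir.right, .A)
  | .B, .s0 => (.s1, Dir.left, .B)
  | .B, .s1 => (.s1, Dir.left, .A)
  | .B, .s2 => (.s3, Dir.right, .B)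
  | .B, .s3 => (.s1, Dir.right, .H)
  | .H, a => (a, Dir.right, .H)

/-- One computation step; `none` if the current state is the halting state `H`. -/
def step (c : Cfg) : Option Cfg :=
  if c.1 = TSt.H then none
  else
    let t := delta c.1 c.2.head
    some (t.2.2, (c.2.write t.1).move t.2.1)

/-- `reaches t c₁ c₂` : iterating `step` exactly `t` times starting from `c₁` yields `c₂`. -/
def reaches (t : ℕ) (c₁ c₂ : Cfg) : Prop :=
  (fun c => Option.bind c step)^[t] (some c₁) = some c₂

/-- The configuration `^ω0 x (q a) y 0^ω` : state `q`, head reading `a`, the word `x`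
written immediately to the left of the head (in order), `y` immediately to the right,
blank elsewhere. -/
def mkCfg (x : List Gam) (q : TSt) (a : Gam) (y : List Gam) : Cfg :=
  (q, ⟨a, ListBlank.mk x.reverse, ListBlank.mk y⟩)

theorem reaches_refl (c : Cfg) : reaches 0 c c := rfl

theorem reaches_trans {m n : ℕ} {a b c : Cfg} (hab : reaches m a b) (hbc : reaches n b c) :
    reaches (m + n) a c := by
  unfold reaches at *
  rw [Nat.add_comm, Function.iterate_add_apply, hab, hbc]

theorem reaches_of_step {a b : Cfg} (h : step a = some b) : reaches 1 a b := h

theorem reaches_congr {m n : ℕ} {a b : Cfg} (h : reaches m a b) (hmn : m = n) :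
    reaches n a b := hmn ▸ h

/-- The block of `n` copies of `s` in front of the half-tape `L`. -/
def block (s : Gam) : ℕ → ListBlank Gam → ListBlank Gam
  | 0, L => L
  | n + 1, L => (block s n L).cons s

theorem block_cons (s : Gam) (n : ℕ) (L : ListBlank Gam) :
    block s n (L.cons s) = block s (n + 1) L := by
  induction n with
  | zero => rfl
  | succ n ih => exact congrArg (ListBlank.cons s) ih

theorem block_mk (s : Gam) (n : ℕ) (l : List Gam) :
    block s n (ListBlank.mk l) = ListBlank.mk (List.replicate n s ++ l) := by
  induction n with
  | zero => rfl
  | succ n ih => rw [block, ih]; rfl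

/-- The blank half-tape. -/
def blankHalf : ListBlank Gam := ListBlank.mk []

theorem cons_blankHalf : ListBlank.cons Gam.s0 blankHalf = blankHalf :=
  ListBlank.cons_head_tail blankHalf

/-- The configuration whose head reads the first cell of the right half-tape `R`. -/
def headRight (q : TSt) (L R : ListBlank Gam) : Cfg := (q, ⟨R.head, L, R.tail⟩)

/-- The configuration whose head reads the first cell of the left half-tape `L`. -/
def headLeft (q : TSt) (L R : ListBlank Gam) : Cfg := (q, ⟨L.head, L.tail, R⟩)

theorem reaches_headRight_of_right {q q' : TSt} {a b : Gam} (hq : q ≠ .H)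
    (h : delta q a = (b, Dir.right, q')) (L R : ListBlank Gam) :
    reaches 1 (headRight q L (R.cons a)) (headRight q' (L.cons b) R) := by
  apply reaches_of_step
  simp [step, headRight, hq, h, Tape.write, Tape.move]

theorem reaches_headRight_of_left {q q' : TSt} {a b : Gam} (hq : q ≠ .H)
    (h : delta q a = (b, Dir.left, q')) (L R : ListBlank Gam) :
    reaches 1 (headRight q L (R.cons a)) (headLeft q' L (R.cons b)) := by
  apply reaches_of_step
  simp [step, headRight, headLeft, hq, h, Tape.write, Tape.move]

theorem headLeft_cons (q : TSt) (a : Gam) (L R : ListBlank Gam) :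
    headLeft q (L.cons a) R = headRight q L (R.cons a) := by
  simp [headLeft, headRight]

theorem reaches_headLeft_of_right {q q' : TSt} {a b : Gam} (hq : q ≠ .H)
    (h : delta q a = (b, Dir.right, q')) (L R : ListBlank Gam) :
    reaches 1 (headLeft q (L.cons a) R) (headRight q' (L.cons b) R) := by
  rw [headLeft_cons]
  exact reaches_headRight_of_right hq h L R

theorem reaches_headLeft_of_left {q q' : TSt} {a b : Gam} (hq : q ≠ .H)
    (h : delta q a = (b, Dir.left, q')) (L R : ListBlank Gam) :
    reaches 1 (headLeft q (L.cons a) R) (headLeft q' L (R.cons b)) := by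
  rw [headLeft_cons]
  exact reaches_headRight_of_left hq h L R

/-- A right-moving loop transition sweeps over a whole block. -/
theorem reaches_sweep_right {q : TSt} {a b : Gam} (hq : q ≠ .H)
    (h : delta q a = (b, Dir.right, q)) (n : ℕ) (L R : ListBlank Gam) :
    reaches n (headRight q L (block a n R)) (headRight q (block b n L) R) := by
  induction n generalizing L with
  | zero => exact reaches_refl _
  | succ n ih =>
    have h₂ := ih (L.cons b)
    rw [block_cons] at h₂
    exact reaches_congr (reaches_trans (reaches_headRight_of_right hq h L _) h₂)
      (Nat.add_comm _ _)

/-- A left-moving loop transition sweeps over a whole block. -/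
theorem reaches_sweep_left {q : TSt} {a b : Gam} (hq : q ≠ .H)
    (h : delta q a = (b, Dir.left, q)) (n : ℕ) (L R : ListBlank Gam) :
    reaches n (headLeft q (block a n L) R) (headLeft q L (block b n R)) := by
  induction n generalizing R with
  | zero => exact reaches_refl _
  | succ n ih =>
    have h₂ := ih (R.cons b)
    rw [block_cons] at h₂
    exact reaches_congr (reaches_trans (reaches_headLeft_of_left hq h _ R) h₂)
      (Nat.add_comm _ _)

/-- Bouncing off a `1` on the right consumes one `3` and lengthens the block of `2`s. -/
theorem reaches_bounce (m : ℕ) (L R : ListBlank Gam) :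
    reaches (2 * m + 3) (headLeft .A (L.cons .s3) (block .s2 m (R.cons .s1)))
      (headLeft .A L (block .s2 (m + 2) R)) := by
  have h₁ := reaches_headLeft_of_right (q := .A) (a := .s3) (by decide) rfl
    L (block .s2 m (R.cons .s1))
  have h₂ := reaches_sweep_right (q := .A) (a := .s2) (by decide) rfl m (L.cons .s1) (R.cons .s1)
  have h₃ := reaches_headRight_of_left (q := .A) (a := .s1) (by decide) rfl
    (block .s1 m (L.cons .s1)) R
  rw [block_cons] at h₂ h₃
  have h₄ := reaches_sweep_left (q := .A) (a := .s1) (by decide) rfl (m + 1) L (R.cons .s2)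
  rw [block_cons] at h₄
  exact reaches_congr (reaches_trans (reaches_trans (reaches_trans h₁ h₂) h₃) h₄) (by ring)

/-- Consuming one `3` and then sweeping over the `2`s up to the right end of the tape. -/
theorem reaches_runout (m : ℕ) (L : ListBlank Gam) :
    reaches (m + 1) (headLeft .A (L.cons .s3) (block .s2 m blankHalf))
      (headRight .A (block .s1 (m + 1) L) blankHalf) := by
  have h₁ := reaches_headLeft_of_right (q := .A) (a := .s3) (by decide) rfl
    L (block .s2 m blankHalf)
  have h₂ := reaches_sweep_right (q := .A) (a := .s2) (by decide) rfl m (L.cons .s1) blankHalf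
  rw [block_cons] at h₂
  exact reaches_congr (reaches_trans h₁ h₂) (Nat.add_comm _ _)

/-- Turning around at the right end of the tape. -/
theorem reaches_turn_right (b : ℕ) (L : ListBlank Gam) :
    reaches (b + 3) (headRight .A (block .s1 b L) blankHalf)
      (headLeft .A L (block .s2 b ((blankHalf.cons .s1).cons .s1))) := by
  have h₁ := reaches_headRight_of_right (q := .A) (a := .s0) (by decide) rfl
    (block .s1 b L) blankHalf
  have h₂ := reaches_headRight_of_left (q := .B) (a := .s0) (by decide) rfl
    ((block .s1 b L).cons .s1) blankHalf
  rw [cons_blankHalf] at h₁ h₂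
  have h₃ := reaches_headLeft_of_left (q := .B) (a := .s1) (by decide) rfl (block .s1 b L)
    (blankHalf.cons .s1)
  have h₄ := reaches_sweep_left (q := .A) (a := .s1) (by decide) rfl b L
    ((blankHalf.cons .s1).cons .s1)
  exact reaches_congr (reaches_trans (reaches_trans (reaches_trans h₁ h₂) h₃) h₄) (by ring)

/-- Turning around at the left end of the tape, up to the first cell after the `2`s. -/
theorem reaches_turn_left (m : ℕ) (R : ListBlank Gam) :
    reaches (m + 3) (headLeft .A (blankHalf.cons .s1) (block .s2 m R))
      (headRight .B (block .s3 (m + 1) (blankHalf.cons .s1)) R) := by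
  have h₁ := reaches_headLeft_of_left (q := .A) (a := .s1) (by decide) rfl blankHalf (block .s2 m R)
  have h₂ := reaches_headLeft_of_right (q := .A) (a := .s0) (by decide) rfl blankHalf
    ((block .s2 m R).cons .s2)
  rw [cons_blankHalf] at h₂
  have h₃ := reaches_sweep_right (q := .B) (a := .s2) (by decide) rfl (m + 1)
    (blankHalf.cons .s1) R
  exact reaches_congr (reaches_trans (reaches_trans h₁ h₂) h₃) (by ring)

/-- The configuration `^ω0 1 3^a 1^b (A0) 0^ω`. -/
def era (a b : ℕ) : Cfg :=
  headRight .A (block .s1 b (block .s3 a (blankHalf.cons .s1))) blankHalf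

theorem reaches_era_add_three (a b : ℕ) :
    reaches (6 * b + 18) (era (a + 3) b) (era a (b + 5)) := by
  have h₁ := reaches_turn_right b (block .s3 (a + 3) (blankHalf.cons .s1))
  have h₂ := reaches_bounce b (block .s3 (a + 2) (blankHalf.cons .s1)) (blankHalf.cons .s1)
  have h₃ := reaches_bounce (b + 2) (block .s3 (a + 1) (blankHalf.cons .s1)) blankHalf
  have h₄ := reaches_runout (b + 4) (block .s3 a (blankHalf.cons .s1))
  exact reaches_congr (reaches_trans (reaches_trans (reaches_trans h₁ h₂) h₃) h₄) (by ring)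

theorem reaches_era_iterate (k r b : ℕ) :
    reaches (6 * b * k + 15 * k ^ 2 + 3 * k) (era (3 * k + r) b) (era r (b + 5 * k)) := by
  induction k generalizing b with
  | zero => simpa using reaches_refl (era r b)
  | succ k ih =>
    have h₁ := reaches_era_add_three (3 * k + r) b
    have h₂ := ih (b + 5)
    rw [show 3 * k + r + 3 = 3 * (k + 1) + r by ring] at h₁
    rw [show b + 5 + 5 * k = b + 5 * (k + 1) by ring] at h₂
    exact reaches_congr (reaches_trans h₁ h₂) (by ring)

theorem reaches_era_zero (b : ℕ) :
    reaches (2 * b + 26) (era 0 (b + 2)) (era b 5) := by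
  have h₁ := reaches_turn_right (b + 2) (blankHalf.cons .s1)
  have h₂ := reaches_turn_left (b + 2) ((blankHalf.cons .s1).cons .s1)
  have h₃ := reaches_headRight_of_left (q := .B) (a := .s1) (by decide) rfl
    (block .s3 (b + 3) (blankHalf.cons .s1)) (blankHalf.cons .s1)
  have h₄ := reaches_bounce 0 (block .s3 (b + 2) (blankHalf.cons .s1)) (blankHalf.cons .s1)
  have h₅ := reaches_bounce 2 (block .s3 (b + 1) (blankHalf.cons .s1)) blankHalf
  have h₆ := reaches_runout 4 (block .s3 b (blankHalf.cons .s1))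
  exact reaches_congr (reaches_trans (reaches_trans (reaches_trans (reaches_trans
    (reaches_trans h₁ h₂) h₃) h₄) h₅) h₆) (by ring)

theorem reaches_era_one (b : ℕ) :
    reaches (4 * b + 18) (era 1 b) (era (b + 1) 3) := by
  have h₁ := reaches_turn_right b (block .s3 1 (blankHalf.cons .s1))
  have h₂ := reaches_bounce b (blankHalf.cons .s1) (blankHalf.cons .s1)
  have h₃ := reaches_turn_left (b + 2) (blankHalf.cons .s1)
  have h₄ := reaches_headRight_of_left (q := .B) (a := .s1) (by decide) rfl
    (block .s3 (b + 3) (blankHalf.cons .s1)) blankHalf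
  have h₅ := reaches_bounce 0 (block .s3 (b + 2) (blankHalf.cons .s1)) blankHalf
  have h₆ := reaches_runout 2 (block .s3 (b + 1) (blankHalf.cons .s1))
  exact reaches_congr (reaches_trans (reaches_trans (reaches_trans (reaches_trans
    (reaches_trans h₁ h₂) h₃) h₄) h₅) h₆) (by ring)

theorem reaches_era_two (b : ℕ) :
    reaches (6 * b + 22) (era 2 b)
      (headRight .H ((block .s3 (b + 4) (blankHalf.cons .s1)).cons .s1)
        (blankHalf.cons .s1)) := by
  have h₁ := reaches_turn_right b (block .s3 2 (blankHalf.cons .s1))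
  have h₂ := reaches_bounce b (block .s3 1 (blankHalf.cons .s1)) (blankHalf.cons .s1)
  have h₃ := reaches_bounce (b + 2) (blankHalf.cons .s1) blankHalf
  have h₄ := reaches_turn_left (b + 4) blankHalf
  have h₅ := reaches_headRight_of_left (q := .B) (a := .s0) (by decide) rfl
    (block .s3 (b + 5) (blankHalf.cons .s1)) blankHalf
  rw [cons_blankHalf] at h₅
  have h₆ := reaches_headLeft_of_right (q := .B) (a := .s3) (by decide) rfl
    (block .s3 (b + 4) (blankHalf.cons .s1)) (blankHalf.cons .s1)
  exact reaches_congr (reaches_trans (reaches_trans (reaches_trans (reaches_trans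
    (reaches_trans h₁ h₂) h₃) h₄) h₅) h₆) (by ring)

/-- The blank tape leads to the first configuration of the form `era a b`. -/
theorem reaches_era_of_blank : reaches 24 (mkCfg [] .A .s0 []) (era 1 3) := by
  have h₁ := reaches_headRight_of_right (q := .A) (a := .s0) (by decide) rfl blankHalf blankHalf
  have h₂ := reaches_headRight_of_left (q := .B) (a := .s0) (by decide) rfl
    (blankHalf.cons .s1) blankHalf
  rw [cons_blankHalf] at h₁ h₂
  have h₃ := reaches_headLeft_of_left (q := .B) (a := .s1) (by decide) rfl
    blankHalf (blankHalf.cons .s1)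
  have h₄ := reaches_headLeft_of_right (q := .A) (a := .s0) (by decide) rfl blankHalf
    ((blankHalf.cons .s1).cons .s1)
  rw [cons_blankHalf] at h₄
  have h₅ := reaches_headRight_of_left (q := .B) (a := .s1) (by decide) rfl (blankHalf.cons .s1)
    (blankHalf.cons .s1)
  have h₆ := reaches_turn_left 0 ((blankHalf.cons .s1).cons .s1)
  have h₇ := reaches_headRight_of_left (q := .B) (a := .s1) (by decide) rfl
    (block .s3 1 (blankHalf.cons .s1)) (blankHalf.cons .s1)
  have h₈ := reaches_bounce 0 (blankHalf.cons .s1) (blankHalf.cons .s1)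
  have h₉ := reaches_turn_left 2 (blankHalf.cons .s1)
  have h₁₀ := reaches_headRight_of_left (q := .B) (a := .s1) (by decide) rfl
    (block .s3 3 (blankHalf.cons .s1)) blankHalf
  have h₁₁ := reaches_bounce 0 (block .s3 2 (blankHalf.cons .s1)) blankHalf
  have h₁₂ := reaches_runout 2 (block .s3 1 (blankHalf.cons .s1))
  exact reaches_trans (reaches_trans (reaches_trans (reaches_trans (reaches_trans
    (reaches_trans (reaches_trans (reaches_trans (reaches_trans (reaches_trans (reaches_trans
    h₁ h₂) h₃) h₄) h₅) h₆) h₇) h₈) h₉) h₁₀) h₁₁) h₁₂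

theorem stmt4 :
    reaches 3932964 (mkCfg [] .A .s0 [])
      (mkCfg ([.s1] ++ List.replicate 2047 .s3 ++ [.s1]) .H .s1 []) := by
  have hfinal : headRight .H ((block .s3 2047 (blankHalf.cons .s1)).cons .s1)
      (blankHalf.cons .s1) =
      mkCfg ([.s1] ++ List.replicate 2047 .s3 ++ [.s1]) .H .s1 [] := by
    rw [headRight, mkCfg, blankHalf, ListBlank.cons_mk, block_mk, ListBlank.cons_mk,
      ListBlank.head_mk, ListBlank.tail_mk]
    simp only [List.reverse_append, List.reverse_replicate, List.reverse_singleton]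
    rfl
  rw [← hfinal]
  refine reaches_congr (n := 3932964) (reaches_trans reaches_era_of_blank <|
    reaches_trans (reaches_era_one 3) <|
    reaches_trans (reaches_era_iterate 1 1 3) <|
    reaches_trans (reaches_era_one 8) <|
    reaches_trans (reaches_era_iterate 3 0 3) <|
    reaches_trans (reaches_era_zero 16) <|
    reaches_trans (reaches_era_iterate 5 1 5) <|
    reaches_trans (reaches_era_one 30) <|
    reaches_trans (reaches_era_iterate 10 1 3) <|
    reaches_trans (reaches_era_one 53) <|
    reaches_trans (reaches_era_iterate 18 0 3) <|
    reaches_trans (reaches_era_zero 91) <|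
    reaches_trans (reaches_era_iterate 30 1 5) <|
    reaches_trans (reaches_era_one 155) <|
    reaches_trans (reaches_era_iterate 52 0 3) <|
    reaches_trans (reaches_era_zero 261) <|
    reaches_trans (reaches_era_iterate 87 0 5) <|
    reaches_trans (reaches_era_zero 438) <|
    reaches_trans (reaches_era_iterate 146 0 5) <|
    reaches_trans (reaches_era_zero 733) <|
    reaches_trans (reaches_era_iterate 244 1 5) <|
    reaches_trans (reaches_era_one 1225) <|
    reaches_trans (reaches_era_iterate 408 2 3) <|
    reaches_era_two 2043) ?_
  norm_num
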